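/- arXiv:1507.03058 — 2 statements merged into one kernel-verified Lean document; each statement's English description precedes it below -/
import Mathlib

section
/- Let A, B be nonempty words over 𝔸 = {a,b} with A·B ≠ B·A, and let W_0, δ_a, δ_b be as in the context. Let W be a word in the submonoid generated by {A,B}. If δ_a·W_0 is a suffix of W, then W = V·A for some V in the submonoid generated by {A,B}; similarly, if δ_b·W_0 is a suffix of W, then W = V·B for some V in the submonoid generated by {A,B}. -/
namespace Subst

/-- `pow A m` is the `m`-fold concatenation `A^m`. -/
def pow (A : List Bool) : ℕ → List Bool
  | 0 => []
  | n + 1 => pow A n ++ A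

/-- Membership in the submonoid of `𝔸*` generated by `{A, B}`. -/
inductive GenAB (A B : List Bool) : List Bool → Prop
  | nil : GenAB A B []
  | appA : ∀ {W}, GenAB A B W → GenAB A B (W ++ A)
  | appB : ∀ {W}, GenAB A B W → GenAB A B (W ++ B)

/-- The extension of a substitution `σ : 𝔸 → 𝔸*` to a monoid morphism of `𝔸*`. -/
def subst (σ : Bool → List Bool) : List Bool → List Bool
  | [] => []
  | c :: w => σ c ++ subst σ w

/-- The factor `ξ[i, i+n)` of the infinite sequence `ξ`. -/
def wordAt (ξ : ℕ → Bool) (i n : ℕ) : List Bool :=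
  (List.range n).map fun k => ξ (i + k)

/-- `W` is a factor of the infinite sequence `ξ`. -/
def IsFactor (ξ : ℕ → Bool) (W : List Bool) : Prop :=
  ∃ i, W = wordAt ξ i W.length

/-- `ξ` is a fixed point of `σ`: for every `n`, `σ(ξ[0,n))` is a prefix of `ξ`. -/
def IsFixedPoint (σ : Bool → List Bool) (ξ : ℕ → Bool) : Prop :=
  ∀ n, subst σ (wordAt ξ 0 n) = wordAt ξ 0 (subst σ (wordAt ξ 0 n)).length

/-- `ξ` is recurrent: every factor occurs at infinitely many positions. -/
def Recurrent (ξ : ℕ → Bool) : Prop :=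
  ∀ W, IsFactor ξ W → ∀ N, ∃ i, N ≤ i ∧ W = wordAt ξ i W.length

/-- `ξ` is ultimately periodic. -/
def UltPeriodic (ξ : ℕ → Bool) : Prop :=
  ∃ p, 1 ≤ p ∧ ∃ N, ∀ n, N ≤ n → ξ (n + p) = ξ n

/-- `σ` is non-erasing: the image of each letter is nonempty. -/
def NonErasing (σ : Bool → List Bool) : Prop := ∀ c, σ c ≠ []

/-- `σ` is well-marked: `σ(c)` begins with the letter `c` for each letter `c`. -/
def WellMarked (σ : Bool → List Bool) : Prop := ∀ c, ∃ t, σ c = c :: t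

/-- `σ` is primitive: for some `n ≥ 1`, each letter occurs in `σⁿ(d)` for each letter `d`. -/
def Primitive (σ : Bool → List Bool) : Prop :=
  ∃ n, 1 ≤ n ∧ ∀ c d : Bool, c ∈ (subst σ)^[n] [d]

/-- `W` is a right special factor of `ξ`: both `Wa` and `Wb` are factors of `ξ`. -/
def RightSpecial (ξ : ℕ → Bool) (W : List Bool) : Prop :=
  ∀ c : Bool, IsFactor ξ (W ++ [c])

/-- `W` is a left special factor of `ξ`: both `aW` and `bW` are factors of `ξ`. -/
def LeftSpecial (ξ : ℕ → Bool) (W : List Bool) : Prop :=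
  ∀ c : Bool, IsFactor ξ (c :: W)

/-- A right special factor is strong if all of `aWa, aWb, bWa, bWb` are factors. -/
def StrongSpecial (ξ : ℕ → Bool) (W : List Bool) : Prop :=
  ∀ c d : Bool, IsFactor ξ (c :: (W ++ [d]))

/-- A right special factor is weak if neither `aW` nor `bW` is right special. -/
def WeakSpecial (ξ : ℕ → Bool) (W : List Bool) : Prop :=
  RightSpecial ξ W ∧ ∀ c : Bool, ¬ RightSpecial ξ (c :: W)

/-- The operator `T(W) = W₀ · σ(W)`. -/
def T (σ : Bool → List Bool) (W0 W : List Bool) : List Bool := W0 ++ subst σ W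

/-- Specification of the word `W₀` (the longest common suffix of `A^∞` and `B^∞`)
together with the distinct letters `δ_a, δ_b`:  `δ_c · W₀` is a suffix of some power
of `σ(c)` for each letter `c`, and `δ_a ≠ δ_b`. -/
def W0Spec (σ : Bool → List Bool) (W0 : List Bool) (δ : Bool → Bool) : Prop :=
  δ false ≠ δ true ∧ ∀ c, ∃ m, 1 ≤ m ∧ (δ c :: W0) <:+ pow (σ c) m

/-- The incidence matrix of `σ`: its columns are the Parikh vectors of `σ(a)` and `σ(b)`. -/
def incMat (σ : Bool → List Bool) : Matrix Bool Bool ℤ :=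
  Matrix.of fun c d => ((σ d).count c : ℤ)

end Subst

open Subst
namespace Subst

theorem append_pow_comm (A : List Bool) (m : ℕ) : A ++ pow A m = pow A m ++ A := by
  induction m with
  | zero => simp [pow]
  | succ n ih => rw [pow, ← List.append_assoc, ih]

theorem suffix_append_right {U V : List Bool} (C : List Bool) (h : U <:+ V) :
    U ++ C <:+ V ++ C := by
  obtain ⟨P, rfl⟩ := h
  exact ⟨P, by simp⟩

theorem cons_suffix_append_of_suffix_pow {A W0 : List Bool} {d : Bool} (hA : A ≠ [])
    (h : ∃ m, 1 ≤ m ∧ (d :: W0) <:+ pow A m) : (d :: W0) <:+ W0 ++ A := by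
  obtain ⟨m, -, hm⟩ := h
  have hlong : (d :: W0) <:+ pow A m ++ A :=
    append_pow_comm A m ▸ hm.trans (List.suffix_append A (pow A m))
  have hW0 : W0 ++ A <:+ pow A m ++ A :=
    suffix_append_right A ((List.suffix_cons d W0).trans hm)
  refine List.suffix_of_suffix_length_le hlong hW0 ?_
  have := List.length_pos_iff.mpr hA
  simp only [List.length_cons, List.length_append]
  omega

theorem GenAB.suffix_append {A B W0 W : List Bool} (hA : W0 <:+ W0 ++ A) (hB : W0 <:+ W0 ++ B)
    (hW : GenAB A B W) : W0 <:+ W0 ++ W := by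
  induction hW with
  | nil => simp
  | appA _ ih =>
    rw [← List.append_assoc]
    exact hA.trans (suffix_append_right _ ih)
  | appB _ ih =>
    rw [← List.append_assoc]
    exact hB.trans (suffix_append_right _ ih)

theorem eq_of_cons_suffix {c d : Bool} {U W : List Bool} (hc : (c :: U) <:+ W)
    (hd : (d :: U) <:+ W) : c = d :=
  (List.cons_eq_cons.mp
    ((List.suffix_of_suffix_length_le hc hd (by simp)).eq_of_length (by simp))).1

/-- If `c :: W0` is a suffix of `W0 ++ C` and `W0` is a suffix of `W0 ++ V`, then `c` is the only
letter that can precede a suffix `W0` of `V ++ C`. -/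
theorem eq_of_cons_suffix_append {c d : Bool} {C V W0 : List Bool} (hC : (c :: W0) <:+ W0 ++ C)
    (hV : W0 <:+ W0 ++ V) (hd : (d :: W0) <:+ V ++ C) : c = d := by
  have hc : (c :: W0) <:+ W0 ++ (V ++ C) := by
    rw [← List.append_assoc]
    exact hC.trans (suffix_append_right _ hV)
  exact eq_of_cons_suffix hc (hd.trans (List.suffix_append W0 (V ++ C)))

end Subst

/-- If `W` is in the submonoid generated by `{A,B}` and `δ_a·W₀` is a
suffix of `W`, then `W = V·A` with `V` in the submonoid; similarly for `δ_b` and `B`. -/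
theorem statement3 (A B : List Bool) (hA : A ≠ []) (hB : B ≠ [])
    (hAB : A ++ B ≠ B ++ A)
    (W0 : List Bool) (δa δb : Bool) (hδ : δa ≠ δb)
    (hδa : ∃ m, 1 ≤ m ∧ (δa :: W0) <:+ pow A m)
    (hδb : ∃ k, 1 ≤ k ∧ (δb :: W0) <:+ pow B k) :
    (∀ W, GenAB A B W → (δa :: W0) <:+ W → ∃ V, GenAB A B V ∧ W = V ++ A) ∧
    (∀ W, GenAB A B W → (δb :: W0) <:+ W → ∃ V, GenAB A B V ∧ W = V ++ B) := by
  have hA' := cons_suffix_append_of_suffix_pow hA hδa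
  have hB' := cons_suffix_append_of_suffix_pow hB hδb
  have hgen : ∀ {V}, GenAB A B V → W0 <:+ W0 ++ V := fun hV =>
    hV.suffix_append ((List.suffix_cons δa W0).trans hA') ((List.suffix_cons δb W0).trans hB')
  refine ⟨fun W hW hs => ?_, fun W hW hs => ?_⟩
  · cases hW with
    | nil => simp at hs
    | appA hV => exact ⟨_, hV, rfl⟩
    | appB hV => exact absurd (eq_of_cons_suffix_append hB' (hgen hV) hs).symm hδ
  · cases hW with
    | nil => simp at hs
    | appA hV => exact absurd (eq_of_cons_suffix_append hA' (hgen hV) hs) hδ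
    | appB hV => exact ⟨_, hV, rfl⟩
end

section
/- (Mossé's identifiability) Let σ be a primitive non-erasing substitution over 𝔸 = {a,b} and let ξ be a fixed point of σ that is not ultimately periodic. Let E₁ = { |σ(ξ[0,k))| : k ∈ ℕ } be the set of cutting positions of ξ. Then there exists a constant C ∈ ℕ such that for all i ∈ E₁ with i ≥ C and all j ≥ C: if ξ[i−C, i+C] = ξ[j−C, j+C] (equality of the two factors of length 2C+1), then j ∈ E₁. -/
namespace Subst

section Words

variable {σ : Bool → List Bool} {ξ : ℕ → Bool}

theorem subst_append (σ : Bool → List Bool) (u v : List Bool) :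
    subst σ (u ++ v) = subst σ u ++ subst σ v := by
  induction u with
  | nil => rfl
  | cons c u ih => simp [subst, ih]

theorem subst_singleton (σ : Bool → List Bool) (c : Bool) : subst σ [c] = σ c := by
  simp [subst]

theorem iterate_subst_append (σ : Bool → List Bool) (n : ℕ) (u v : List Bool) :
    (subst σ)^[n] (u ++ v) = (subst σ)^[n] u ++ (subst σ)^[n] v := by
  induction n generalizing u v with
  | zero => rfl
  | succ n ih => simp [subst_append, ih]

theorem iterate_subst_nil (σ : Bool → List Bool) (n : ℕ) : (subst σ)^[n] [] = [] := by
  induction n with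
  | zero => rfl
  | succ n ih => simpa [subst] using ih

theorem subst_iterate (σ : Bool → List Bool) (n : ℕ) (w : List Bool) :
    subst (fun d => (subst σ)^[n] [d]) w = (subst σ)^[n] w := by
  induction w with
  | nil => simp [subst, iterate_subst_nil]
  | cons c w ih =>
    rw [subst, ih, ← iterate_subst_append]
    rfl

theorem mul_length_le_length_subst {r : ℕ} (h : ∀ c, r ≤ (σ c).length) (w : List Bool) :
    r * w.length ≤ (subst σ w).length := by
  induction w with
  | nil => simp
  | cons c w ih =>
    have := h c
    simp only [subst, List.length_cons, List.length_append]
    linarith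

@[simp]
theorem length_wordAt (ξ : ℕ → Bool) (i n : ℕ) : (wordAt ξ i n).length = n := by
  simp [wordAt]

theorem wordAt_add (ξ : ℕ → Bool) (i m n : ℕ) :
    wordAt ξ i (m + n) = wordAt ξ i m ++ wordAt ξ (i + m) n := by
  simp [wordAt, List.range_add, Function.comp_def, add_assoc]

theorem wordAt_one (ξ : ℕ → Bool) (i : ℕ) : wordAt ξ i 1 = [ξ i] := by
  simp [wordAt]

theorem getElem?_wordAt (ξ : ℕ → Bool) {i n t : ℕ} (h : t < n) :
    (wordAt ξ i n)[t]? = some (ξ (i + t)) := by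
  simp [wordAt, h]

theorem eq_of_wordAt_eq {i j n : ℕ} (h : wordAt ξ i n = wordAt ξ j n) {t : ℕ} (ht : t < n) :
    ξ (i + t) = ξ (j + t) := by
  have h' := congrArg (fun w => w[t]?) h
  simpa [getElem?_wordAt ξ ht] using h'

/-- The `k`-th cutting position of `ξ`. -/
def cut (σ : Bool → List Bool) (ξ : ℕ → Bool) (k : ℕ) : ℕ := (subst σ (wordAt ξ 0 k)).length

theorem cut_add (σ : Bool → List Bool) (ξ : ℕ → Bool) (k n : ℕ) :
    cut σ ξ (k + n) = cut σ ξ k + (subst σ (wordAt ξ k n)).length := by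
  simp [cut, wordAt_add, subst_append]

theorem cut_succ (σ : Bool → List Bool) (ξ : ℕ → Bool) (k : ℕ) :
    cut σ ξ (k + 1) = cut σ ξ k + (σ (ξ k)).length := by
  rw [cut_add, wordAt_one, subst_singleton]

theorem IsFixedPoint.subst_wordAt (hfix : IsFixedPoint σ ξ) (k n : ℕ) :
    subst σ (wordAt ξ k n) = wordAt ξ (cut σ ξ k) (subst σ (wordAt ξ k n)).length := by
  have h := hfix (k + n)
  change _ = wordAt ξ 0 (cut σ ξ (k + n)) at h
  rw [cut_add, wordAt_add, wordAt_add, subst_append] at h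
  simpa using (List.append_inj h (by simp [cut])).2

theorem IsFixedPoint.iterate (hfix : IsFixedPoint σ ξ) (M : ℕ) :
    IsFixedPoint (fun d => (subst σ)^[M] [d]) ξ := by
  intro n
  rw [subst_iterate]
  induction M with
  | zero => simp
  | succ M ih =>
    rw [Function.iterate_succ_apply', ih]
    exact hfix _

theorem NonErasing.one_le_length (hne : NonErasing σ) (c : Bool) : 1 ≤ (σ c).length :=
  List.length_pos_iff.2 (hne c)

/-- An increasing sequence of positions reaches every position beyond its first term. -/
theorem exists_le_lt_succ {f : ℕ → ℕ} (hf : StrictMono f) {x : ℕ} (hx : f 0 ≤ x) :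
    ∃ k, f k ≤ x ∧ x < f (k + 1) := by
  classical
  have hex : ∃ k, x < f k := ⟨x + 1, (Nat.lt_succ_self x).trans_le (hf.id_le _)⟩
  obtain ⟨k, hk⟩ : ∃ k, Nat.find hex = k + 1 := by
    refine Nat.exists_eq_succ_of_ne_zero fun h0 => ?_
    have := Nat.find_spec hex
    rw [h0] at this
    omega
  refine ⟨k, not_lt.1 (Nat.find_min hex (by omega)), ?_⟩
  have := Nat.find_spec hex
  rwa [hk] at this

theorem cut_strictMono (hne : NonErasing σ) (ξ : ℕ → Bool) : StrictMono (cut σ ξ) := by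
  refine strictMono_nat_of_lt_succ fun k => ?_
  have := hne.one_le_length (ξ k)
  rw [cut_succ]
  omega

theorem exists_iterate_subst_length_ge (hprim : Primitive σ) (n : ℕ) :
    ∃ N, ∀ c, n ≤ ((subst σ)^[N] [c]).length := by
  obtain ⟨m, -, hm⟩ := hprim
  have h2 : ∀ d, 2 ≤ ((subst σ)^[m] [d]).length := by
    intro d
    have hs : ({false, true} : Finset Bool) ⊆ ((subst σ)^[m] [d]).toFinset := by
      intro c _
      exact List.mem_toFinset.2 (hm c d)
    exact (Finset.card_le_card hs).trans (List.toFinset_card_le _)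
  induction n with
  | zero => exact ⟨0, by simp⟩
  | succ n ih =>
    obtain ⟨N, hN⟩ := ih
    rcases Nat.eq_zero_or_pos n with rfl | hn
    · exact ⟨0, by simp⟩
    refine ⟨m + N, fun c => ?_⟩
    rw [Function.iterate_add_apply, ← subst_iterate]
    have h := mul_length_le_length_subst h2 ((subst σ)^[N] [c])
    have := hN c
    omega

/-- Every prefix of a fixed point of a primitive substitution occurs with bounded gaps. -/
theorem prefix_bounded_gaps (hprim : Primitive σ) (hfix : IsFixedPoint σ ξ) (n : ℕ) :
    ∃ W, ∀ x, ∃ y, x ≤ y ∧ y + n ≤ x + W ∧ ∀ t < n, ξ (y + t) = ξ t := by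
  obtain ⟨N, hN⟩ := exists_iterate_subst_length_ge hprim (n + 1)
  obtain ⟨m, -, hm⟩ := hprim
  set τ : Bool → List Bool := fun d => (subst σ)^[N + m] [d] with hτ
  have hfixτ : IsFixedPoint τ ξ := hfix.iterate _
  have hsplit : ∀ d, ∃ u v, τ d = u ++ (subst σ)^[N] [ξ 0] ++ v := by
    intro d
    obtain ⟨u, v, huv⟩ := List.append_of_mem (hm (ξ 0) d)
    refine ⟨(subst σ)^[N] u, (subst σ)^[N] v, ?_⟩
    rw [hτ]
    simp only
    rw [Function.iterate_add_apply, huv, ← List.singleton_append, iterate_subst_append,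
      iterate_subst_append, List.append_assoc]
  have hneτ : NonErasing τ := by
    intro d hd
    obtain ⟨u, v, huv⟩ := hsplit d
    have hpos := hN (ξ 0)
    simp [hd] at huv
    simp [huv] at hpos
  obtain ⟨B, hB⟩ : ∃ B, ∀ d, (τ d).length ≤ B :=
    ⟨max (τ false).length (τ true).length, by intro d; cases d <;> simp⟩
  refine ⟨2 * B, fun x => ?_⟩
  obtain ⟨k, hk1, hk2⟩ := exists_le_lt_succ (cut_strictMono hneτ ξ) (x := x) (Nat.zero_le x)
  obtain ⟨u, v, huv⟩ := hsplit (ξ (k + 1))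
  have hl := congrArg List.length huv
  simp only [List.length_append] at hl
  have hb1 := hB (ξ (k + 1))
  have hb0 := hB (ξ k)
  have hn := hN (ξ 0)
  rw [cut_succ] at hk2
  refine ⟨cut τ ξ (k + 1) + u.length, ?_, ?_, fun t ht => ?_⟩
  · rw [cut_succ]; omega
  · rw [cut_succ]; omega
  have hblock := hfixτ.subst_wordAt (k + 1) 1
  rw [wordAt_one, subst_singleton, huv] at hblock
  have hpre := hfix.iterate N 1
  rw [wordAt_one, subst_iterate] at hpre
  have h1 := congrArg (fun w => w[u.length + t]?) hblock
  have h2 := congrArg (fun w => w[t]?) hpre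
  rw [getElem?_wordAt ξ (by omega)] at h2
  rw [getElem?_wordAt ξ (by simp; omega), List.append_assoc,
    List.getElem?_append_right (by omega), List.getElem?_append_left (by omega)] at h1
  simp only [Nat.add_sub_cancel_left] at h1
  rw [h2] at h1
  simpa [add_assoc] using h1.symm

/-- Commuting images of the two letters force periodicity. -/
theorem subst_ne_of_not_ultPeriodic (hne : NonErasing σ) (hfix : IsFixedPoint σ ξ)
    (hnp : ¬ UltPeriodic ξ) : σ false ++ σ true ≠ σ true ++ σ false := by
  intro hcomm
  refine hnp ⟨(σ false).length, hne.one_le_length _, 0, fun n _ => ?_⟩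
  have hw : ∀ w, σ false ++ subst σ w = subst σ w ++ σ false := by
    intro w
    induction w with
    | nil => simp [subst]
    | cons c w ih =>
      have hc : σ false ++ σ c = σ c ++ σ false := by cases c <;> simp [hcomm]
      rw [subst, ← List.append_assoc, hc, List.append_assoc, ih, List.append_assoc]
  set k := n + (σ false).length + 1
  have h := hw (wordAt ξ 0 k)
  rw [hfix k] at h
  have hlen : k ≤ (subst σ (wordAt ξ 0 k)).length := (cut_strictMono hne ξ).id_le k
  have h1 := congrArg (fun w => w[(σ false).length + n]?) h
  rw [List.getElem?_append_right (by omega), List.getElem?_append_left (by simp; omega),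
    getElem?_wordAt ξ (by omega), getElem?_wordAt ξ (by omega)] at h1
  simp only [Nat.add_sub_cancel_left, zero_add, Option.some.injEq] at h1
  rw [h1, add_comm]

/-- Two distinct words of equal length split at their first difference. -/
theorem exists_first_difference {u v : List Bool} (hlen : u.length = v.length) (h : u ≠ v) :
    ∃ z α β, α ≠ β ∧ z ++ [α] <+: u ∧ z ++ [β] <+: v := by
  induction u generalizing v with
  | nil => exact absurd (List.length_eq_zero_iff.1 hlen.symm).symm h
  | cons c u ih =>
    cases v with
    | nil => simp at hlen
    | cons d v =>
      by_cases hcd : c = d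
      · subst hcd
        obtain ⟨z, α, β, hαβ, hu, hv⟩ := ih (by simpa using hlen) (by simpa using h)
        exact ⟨c :: z, α, β, hαβ, by simpa using hu, by simpa using hv⟩
      · exact ⟨[], c, d, hcd, by simp, by simp⟩

/-- If `zα` is a prefix of `AB` and `z` is a prefix of `BA`, then `zα` is a prefix of `Az`. -/
theorem concat_prefix_append {A B z : List Bool} {α : Bool} (hA : A ≠ [])
    (h1 : z ++ [α] <+: A ++ B) (h2 : z <+: B ++ A) : z ++ [α] <+: A ++ z := by
  rcases Nat.lt_or_ge z.length A.length with hz | hz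
  · have : z ++ [α] <+: A :=
      List.prefix_of_prefix_length_le h1 (List.prefix_append A B) (by simp; omega)
    exact this.trans (List.prefix_append A z)
  · have hAz : A <+: z ++ [α] :=
      List.prefix_of_prefix_length_le (List.prefix_append A B) h1 (by simp; omega)
    obtain ⟨s, hs⟩ := hAz
    rw [← hs, List.prefix_append_right_inj] at h1
    rw [← hs, List.prefix_append_right_inj]
    have hA' := List.length_pos_iff.2 hA
    have hl := congrArg List.length hs
    simp only [List.length_append, List.length_singleton] at hl
    exact List.prefix_of_prefix_length_le (h1.trans (List.prefix_append B A)) h2 (by omega)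

/-- When the images of the letters do not commute, some word `z` conjugates `σ` to a substitution
whose images of the two letters start with distinct letters `φ false` and `φ true`. -/
theorem exists_conjugating_word (hne : NonErasing σ)
    (h : σ false ++ σ true ≠ σ true ++ σ false) :
    ∃ (z : List Bool) (φ : Bool → Bool), Function.Injective φ ∧ ∀ c, z ++ [φ c] <+: σ c ++ z := by
  obtain ⟨z, α, β, hαβ, h1, h2⟩ := exists_first_difference (by simp [add_comm]) h
  refine ⟨z, fun c => if c then β else α, ?_, ?_⟩
  · intro c d hcd
    cases c <;> cases d <;> simp_all
  · have hz1 := (List.prefix_append z [α]).trans h1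
    have hz2 := (List.prefix_append z [β]).trans h2
    intro c
    cases c
    · simpa using concat_prefix_append (hne _) h1 hz2
    · simpa using concat_prefix_append (hne _) h2 hz1

theorem prefix_subst_append {z : List Bool} (hz : ∀ c, z <+: σ c ++ z) (w : List Bool) :
    z <+: subst σ w ++ z := by
  induction w with
  | nil => simp [subst]
  | cons c w ih =>
    rw [subst, List.append_assoc]
    exact (hz c).trans ((List.prefix_append_right_inj _).2 ih)

/-- The conjugating word `z` occurs at every cutting position. -/
theorem wordAt_cut_eq (hne : NonErasing σ) (hfix : IsFixedPoint σ ξ) {z : List Bool}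
    (hz : ∀ c, z <+: σ c ++ z) (k : ℕ) : wordAt ξ (cut σ ξ k) z.length = z := by
  have h := prefix_subst_append hz (wordAt ξ k z.length)
  have hlen := mul_length_le_length_subst hne.one_le_length (wordAt ξ k z.length)
  simp only [length_wordAt, one_mul] at hlen
  have h' : z <+: subst σ (wordAt ξ k z.length) :=
    List.prefix_of_prefix_length_le h (List.prefix_append _ _) hlen
  rw [hfix.subst_wordAt] at h'
  obtain ⟨r, hr⟩ := Nat.exists_eq_add_of_le hlen
  rw [hr, wordAt_add] at h'
  exact (List.prefix_of_prefix_length_le h' (List.prefix_append _ _) (by simp)).eq_of_length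
    (by simp) |>.symm

/-- Each block starting at a cutting position is followed by the conjugating word. -/
theorem wordAt_cut_block (hne : NonErasing σ) (hfix : IsFixedPoint σ ξ) {z : List Bool}
    (hz : ∀ c, z <+: σ c ++ z) (k : ℕ) :
    wordAt ξ (cut σ ξ k) ((σ (ξ k)).length + z.length) = σ (ξ k) ++ z := by
  have h := hfix.subst_wordAt k 1
  rw [wordAt_one, subst_singleton] at h
  rw [wordAt_add, ← cut_succ, wordAt_cut_eq hne hfix hz, ← h]

end Words

section Synchronization

/-- A sequence over a finite alphabet in which, up to position `L`, each window of length `R`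
determines the next term has a small period on `[K, L]`, where `K` is the number of windows. -/
theorem exists_period_of_deterministic {α : Type*} [Fintype α] (X : ℕ → α) (R L : ℕ)
    (hdet : ∀ n m, n + R ≤ L → m + R ≤ L → (∀ t < R, X (n + t) = X (m + t)) →
      X (n + R) = X (m + R)) :
    ∃ p, 1 ≤ p ∧ p ≤ Fintype.card α ^ R ∧
      ∀ n, Fintype.card α ^ R ≤ n → n + p ≤ L → X (n + p) = X n := by
  classical
  set K := Fintype.card α ^ R with hK
  obtain ⟨x, y, hxy, hwin⟩ := Fintype.exists_ne_map_eq_of_card_lt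
    (fun n : Fin (K + 1) => fun t : Fin R => X (n + t)) (by simp [hK])
  obtain ⟨n₁, n₂, hlt, hn₂, hwin⟩ : ∃ n₁ n₂ : ℕ, n₁ < n₂ ∧ n₂ ≤ K ∧
      ∀ t < R, X (n₁ + t) = X (n₂ + t) := by
    rcases lt_or_gt_of_ne hxy with h | h
    · exact ⟨x, y, h, by omega, fun t ht => congrFun hwin ⟨t, ht⟩⟩
    · exact ⟨y, x, h, by omega, fun t ht => (congrFun hwin ⟨t, ht⟩).symm⟩
  have key : ∀ s, n₂ + s ≤ L → X (n₁ + s) = X (n₂ + s) := by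
    intro s
    induction s using Nat.strong_induction_on with
    | _ s ih =>
      intro hs
      rcases Nat.lt_or_ge s R with hsR | hsR
      · exact hwin s hsR
      · obtain ⟨r, rfl⟩ := Nat.exists_eq_add_of_le' hsR
        simp only [← add_assoc] at hs ⊢
        refine hdet _ _ (by omega) hs fun t ht => ?_
        simp only [add_assoc]
        exact ih (r + t) (by omega) (by omega)
  refine ⟨n₂ - n₁, by omega, by omega, fun n hn hnL => ?_⟩
  have := key (n - n₁) (by omega)
  rw [show n₁ + (n - n₁) = n by omega, show n₂ + (n - n₁) = n + (n₂ - n₁) by omega] at this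
  exact this.symm

/-- Positions at which a point `ξ` is cut into blocks, the letter read at each cut determining
the whole block that starts there: a block starting with `c` has length `g c` and its letters are
listed by `h c`. -/
structure IsCutting (ξ : ℕ → Bool) (f : ℕ → ℕ) (g : Bool → ℕ) (h : Bool → ℕ → Bool) : Prop where
  pos : ∀ c, 1 ≤ g c
  succ : ∀ k, f (k + 1) = f k + g (ξ (f k))
  block : ∀ k, ∀ t < g (ξ (f k)), ξ (f k + t) = h (ξ (f k)) t

namespace IsCutting

variable {ξ : ℕ → Bool} {f : ℕ → ℕ} {g : Bool → ℕ} {h : Bool → ℕ → Bool}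

theorem strictMono (H : IsCutting ξ f g h) : StrictMono f := by
  refine strictMono_nat_of_lt_succ fun k => ?_
  have := H.pos (ξ (f k))
  rw [H.succ]
  omega

/-- Block decomposition of a position: `x` lies `d` letters after a cut. -/
theorem exists_cut_le (H : IsCutting ξ f g h) {a : ℕ} (ha : f 0 ≤ a) {x R : ℕ}
    (hR : ∀ c, g c ≤ R) (hx : R ≤ x + 1) :
    ∃ y ≤ x, a + y ∈ Set.range f ∧ x < y + g (ξ (a + y)) := by
  obtain ⟨k, hk1, hk2⟩ := exists_le_lt_succ H.strictMono (x := a + x) (by omega)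
  rw [H.succ] at hk2
  have := hR (ξ (f k))
  refine ⟨f k - a, by omega, ?_⟩
  rw [show a + (f k - a) = f k by omega]
  exact ⟨⟨k, rfl⟩, by omega⟩

theorem mem_range_iff (H : IsCutting ξ f g h) {a : ℕ} (ha : f 0 ≤ a) {x R : ℕ}
    (hR : ∀ c, g c ≤ R) (hR1 : 1 ≤ R) (hx : R ≤ x) :
    a + x ∈ Set.range f ↔ ∃ y < x, a + y ∈ Set.range f ∧ x = y + g (ξ (a + y)) := by
  constructor
  · rintro ⟨k, hk⟩
    rcases k with _ | k
    · omega
    · have hs := H.succ k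
      have := hR (ξ (f k))
      have := H.pos (ξ (f k))
      refine ⟨f k - a, by omega, ?_⟩
      rw [show a + (f k - a) = f k by omega]
      exact ⟨⟨k, rfl⟩, by omega⟩
  · rintro ⟨y, -, ⟨k, hk⟩, hxy⟩
    refine ⟨k + 1, ?_⟩
    rw [H.succ, hk]
    omega

/-- If cuts at `a + t` and `b + t` match and the letters agree from there on, all further cuts
match. -/
theorem mem_range_of_common_cut (H : IsCutting ξ f g h) {a b t L : ℕ}
    (hab : ∀ s ≤ L, ξ (a + s) = ξ (b + s)) (ht : t ≤ L) (hat : a + t ∈ Set.range f)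
    (hbt : b + t ∈ Set.range f) (haL : a + L ∈ Set.range f) : b + L ∈ Set.range f := by
  obtain ⟨k₀, hk₀⟩ := hat
  obtain ⟨k₁, hk₁⟩ := hbt
  obtain ⟨k, hk⟩ := haL
  have hkk : k₀ ≤ k := H.strictMono.le_iff_le.1 (by omega)
  obtain ⟨s, rfl⟩ := Nat.exists_eq_add_of_le hkk
  have key : ∀ r ≤ s, ∃ q ≤ L, f (k₀ + r) = a + q ∧ f (k₁ + r) = b + q := by
    intro r
    induction r with
    | zero => exact fun _ => ⟨t, ht, hk₀, hk₁⟩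
    | succ r ih =>
      intro hr
      obtain ⟨q, hq, hq0, hq1⟩ := ih (by omega)
      have hle : f (k₀ + (r + 1)) ≤ f (k₀ + s) := H.strictMono.monotone (by omega)
      have e0 := H.succ (k₀ + r)
      have e1 := H.succ (k₁ + r)
      rw [hq0] at e0
      rw [hq1, ← hab q hq] at e1
      refine ⟨q + g (ξ (a + q)), ?_, ?_, ?_⟩
      · rw [← add_assoc] at hle; omega
      · rw [← add_assoc]; omega
      · rw [← add_assoc]; omega
  obtain ⟨q, -, hq0, hq1⟩ := key s le_rfl
  exact ⟨k₁ + s, by omega⟩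

/-- Two cuttings of the same word without common cut force a small period. -/
theorem exists_period_of_disjoint (H : IsCutting ξ f g h) {R : ℕ} (hR : ∀ c, g c ≤ R)
    {a b L : ℕ} (ha : f 0 ≤ a) (hb : f 0 ≤ b) (hab : ∀ s ≤ L, ξ (a + s) = ξ (b + s))
    (hdisj : ∀ t ≤ L, a + t ∈ Set.range f → b + t ∉ Set.range f) :
    ∃ p, 1 ≤ p ∧ p ≤ 8 ^ R ∧ ∀ n, 8 ^ R ≤ n → n + p ≤ L → ξ (b + (n + p)) = ξ (b + n) := by
  classical
  have hR1 : 1 ≤ R := (H.pos true).trans (hR true)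
  let X : ℕ → Bool × Bool × Bool := fun n =>
    (ξ (b + n), decide (a + n ∈ Set.range f), decide (b + n ∈ Set.range f))
  have hX : ∀ n m, X n = X m ↔ ξ (b + n) = ξ (b + m) ∧
      (a + n ∈ Set.range f ↔ a + m ∈ Set.range f) ∧
      (b + n ∈ Set.range f ↔ b + m ∈ Set.range f) := by
    intro n m
    simp only [X, Prod.mk.injEq, decide_eq_decide]
  suffices hdet : ∀ n m, n + R ≤ L → m + R ≤ L → (∀ t < R, X (n + t) = X (m + t)) →
      X (n + R) = X (m + R) by
    obtain ⟨p, hp1, hp2, hp⟩ := exists_period_of_deterministic X R L hdet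
    have hcard : Fintype.card (Bool × Bool × Bool) = 8 := rfl
    rw [hcard] at hp2 hp
    exact ⟨p, hp1, hp2, fun n hn hnL => ((hX _ _).1 (hp n hn hnL)).1⟩
  intro n m hn hm hwin
  simp only [hX] at hwin ⊢
  have hblock : ∀ c ∈ ({a, b} : Set ℕ), ∀ y, c + y ∈ Set.range f → ∀ t < g (ξ (b + y)),
      y + t ≤ L → ξ (b + (y + t)) = h (ξ (b + y)) t := by
    rintro c hc y ⟨k, hk⟩ t ht hyt
    have hB := H.block k
    rw [hk] at hB
    rcases hc with rfl | rfl
    · rw [← hab y (by omega)] at ht ⊢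
      rw [← hab _ hyt, ← hB t ht, add_assoc]
    · rw [← hB t ht, add_assoc]
  have hcover : ∀ c ∈ ({a, b} : Set ℕ), ∀ x, x ≤ L → R ≤ x + 1 →
      ∃ y ≤ x, c + y ∈ Set.range f ∧ x < y + g (ξ (b + y)) := by
    intro c hc x hxL hx
    rcases hc with rfl | rfl
    · obtain ⟨y, hy, hyf, hlt⟩ := H.exists_cut_le ha hR hx
      exact ⟨y, hy, hyf, by rwa [← hab y (by omega)]⟩
    · exact H.exists_cut_le hb hR hx
  have hmem : ∀ c ∈ ({a, b} : Set ℕ), ∀ x, x ≤ L → R ≤ x →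
      (c + x ∈ Set.range f ↔ ∃ y < x, c + y ∈ Set.range f ∧ x = y + g (ξ (b + y))) := by
    intro c hc x hxL hx
    rcases hc with rfl | rfl
    · rw [H.mem_range_iff ha hR hR1 hx]
      refine exists_congr fun y => and_congr_right fun hy => ?_
      rw [hab y (by omega)]
    · exact H.mem_range_iff hb hR hR1 hx
  -- the cut marks at distance `R` are read off the window
  have htransfer : ∀ c ∈ ({a, b} : Set ℕ), ∀ n m, n + R ≤ L → m + R ≤ L →
      (∀ t < R, ξ (b + (n + t)) = ξ (b + (m + t)) ∧
        (c + (n + t) ∈ Set.range f ↔ c + (m + t) ∈ Set.range f)) →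
      c + (n + R) ∈ Set.range f → c + (m + R) ∈ Set.range f := by
    intro c hc n m hn hm hw hcn
    rw [hmem c hc _ hn (by omega)] at hcn
    rw [hmem c hc _ hm (by omega)]
    obtain ⟨y, hy, hyf, hyx⟩ := hcn
    have hgR := hR (ξ (b + y))
    obtain ⟨t, rfl⟩ : ∃ t, y = n + t := ⟨y - n, by omega⟩
    obtain ⟨hw1, hw2⟩ := hw t (by omega)
    exact ⟨m + t, by omega, hw2.1 hyf, by rw [← hw1]; omega⟩
  -- so is the letter, as soon as the block containing it starts strictly before
  have hletter : ∀ c ∈ ({a, b} : Set ℕ),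
      (∀ t < R, c + (n + t) ∈ Set.range f → c + (m + t) ∈ Set.range f) →
      c + (n + R) ∉ Set.range f → ξ (b + (n + R)) = ξ (b + (m + R)) := by
    intro c hc hw hcn
    obtain ⟨y, hy, hyf, hlt⟩ := hcover c hc (n + R) hn (by omega)
    have hgR := hR (ξ (b + y))
    have hne : y ≠ n + R := by rintro rfl; exact hcn hyf
    obtain ⟨t, rfl⟩ : ∃ t, y = n + t := ⟨y - n, by omega⟩
    have hw1 := (hwin t (by omega)).1
    have e1 := hblock c hc (n + t) hyf (R - t) (by omega) (by omega)
    have e2 := hblock c hc (m + t) (hw t (by omega) hyf) (R - t) (by rw [← hw1]; omega) (by omega)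
    rw [show n + t + (R - t) = n + R by omega] at e1
    rw [show m + t + (R - t) = m + R by omega] at e2
    rw [e1, e2, hw1]
  have ha' : a ∈ ({a, b} : Set ℕ) := by simp
  have hb' : b ∈ ({a, b} : Set ℕ) := by simp
  refine ⟨?_, ⟨?_, ?_⟩, ⟨?_, ?_⟩⟩
  · by_cases hcut : a + (n + R) ∈ Set.range f
    · exact hletter b hb' (fun t ht => (hwin t ht).2.2.1) (hdisj _ hn hcut)
    · exact hletter a ha' (fun t ht => (hwin t ht).2.1.1) hcut
  · exact htransfer a ha' n m hn hm fun t ht => ⟨(hwin t ht).1, (hwin t ht).2.1⟩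
  · exact htransfer a ha' m n hm hn fun t ht => ⟨(hwin t ht).1.symm, (hwin t ht).2.1.symm⟩
  · exact htransfer b hb' n m hn hm fun t ht => ⟨(hwin t ht).1, (hwin t ht).2.2⟩
  · exact htransfer b hb' m n hm hn fun t ht => ⟨(hwin t ht).1.symm, (hwin t ht).2.2.symm⟩

end IsCutting

/-- If every prefix of `ξ` occurs with bounded gaps and `ξ` is not ultimately periodic, then `ξ`
has no long factors of small period. -/
theorem exists_length_bound_of_period {ξ : ℕ → Bool} (hnp : ¬ UltPeriodic ξ)
    (hrec : ∀ n, ∃ W, ∀ x, ∃ y, x ≤ y ∧ y + n ≤ x + W ∧ ∀ t < n, ξ (y + t) = ξ t) (K : ℕ) :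
    ∃ W, ∀ p, 1 ≤ p → p ≤ K → ∀ x, ¬ ∀ n, n + p ≤ W → ξ (x + (n + p)) = ξ (x + n) := by
  obtain ⟨m, hm⟩ : ∃ m, ξ (m + K.factorial) ≠ ξ m := by
    by_contra! hper
    exact hnp ⟨K.factorial, K.factorial_pos, 0, fun n _ => hper n⟩
  obtain ⟨W, hW⟩ := hrec (m + K.factorial + 1)
  refine ⟨W, fun p hp1 hpK x hper => ?_⟩
  obtain ⟨y, hxy, hyW, hy⟩ := hW x
  obtain ⟨r, hr⟩ := Nat.dvd_factorial hp1 hpK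
  obtain ⟨d, rfl⟩ := Nat.exists_eq_add_of_le hxy
  have key : ∀ s, d + m + p * s ≤ W → ξ (x + (d + m + p * s)) = ξ (x + (d + m)) := by
    intro s
    induction s with
    | zero => simp
    | succ s ih =>
      intro hs
      rw [Nat.mul_succ, ← add_assoc (d + m)] at hs ⊢
      rw [hper _ hs, ih (by omega)]
  have h1 := key r (by rw [← hr]; omega)
  rw [← hr] at h1
  apply hm
  rw [← hy (m + K.factorial) (by omega), ← hy m (by omega)]
  simpa [add_assoc] using h1

theorem exists_isCutting {σ : Bool → List Bool} {ξ : ℕ → Bool} (hne : NonErasing σ)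
    (hfix : IsFixedPoint σ ξ) (hnp : ¬ UltPeriodic ξ) :
    ∃ ℓ g h, IsCutting ξ (fun k => cut σ ξ k + ℓ) g h := by
  obtain ⟨z, φ, hφ, hz⟩ :=
    exists_conjugating_word hne (subst_ne_of_not_ultPeriodic hne hfix hnp)
  have hz' : ∀ c, z <+: σ c ++ z := fun c => (List.prefix_append z [φ c]).trans (hz c)
  obtain ⟨ψ, hψ⟩ := hφ.hasLeftInverse
  have hblock := wordAt_cut_block hne hfix hz'
  have hletter : ∀ k, ξ (cut σ ξ k + z.length) = φ (ξ k) := by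
    intro k
    have hk := hne.one_le_length (ξ k)
    have h1 := congrArg (fun w => w[z.length]?) (hblock k)
    obtain ⟨r, hr⟩ := hz (ξ k)
    simp only [← hr] at h1
    rw [getElem?_wordAt ξ (by omega)] at h1
    simpa using h1
  refine ⟨z.length, fun c => (σ (ψ c)).length, fun c t => (σ (ψ c) ++ z).getD (z.length + t) false,
    fun c => hne.one_le_length _, fun k => ?_, fun k t ht => ?_⟩
  · simp only [hletter, hψ (ξ k), cut_succ]
    omega
  · simp only [hletter, hψ (ξ k)] at ht ⊢
    rw [List.getD_eq_getElem?_getD, ← hblock k, getElem?_wordAt ξ (by omega)]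
    simp [add_assoc]

end Synchronization

end Subst

open Subst
/-- Mossé's identifiability: there is a constant `C` such that whenever
the factor of length `2C+1` centered at a cutting position `i ≥ C` coincides with the
factor of length `2C+1` centered at a position `j ≥ C`, the position `j` is also a
cutting position. -/
theorem statement6 (σ : Bool → List Bool) (hne : NonErasing σ)
    (hprim : Primitive σ)
    (ξ : ℕ → Bool) (hfix : IsFixedPoint σ ξ) (hnp : ¬ UltPeriodic ξ) :
    ∃ C : ℕ, ∀ i, (∃ k, i = (subst σ (wordAt ξ 0 k)).length) → C ≤ i →
      ∀ j, C ≤ j →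
        wordAt ξ (i - C) (2 * C + 1) = wordAt ξ (j - C) (2 * C + 1) →
        ∃ k, j = (subst σ (wordAt ξ 0 k)).length := by
  obtain ⟨ℓ, g, h, H⟩ := exists_isCutting hne hfix hnp
  obtain ⟨R, hR⟩ : ∃ R, ∀ c, g c ≤ R :=
    ⟨max (g false) (g true), by intro c; cases c <;> simp⟩
  obtain ⟨W, hW⟩ :=
    exists_length_bound_of_period hnp (prefix_bounded_gaps hprim hfix) (8 ^ R)
  set L := 8 ^ R + W with hL
  refine ⟨L + ℓ, ?_⟩
  rintro i ⟨k, hk⟩ hi j hj hwin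
  obtain ⟨a, rfl⟩ := Nat.exists_eq_add_of_le' hi
  obtain ⟨b, rfl⟩ := Nat.exists_eq_add_of_le' hj
  simp only [Nat.add_sub_cancel] at hwin
  have hab : ∀ s ≤ L, ξ (a + 2 * ℓ + s) = ξ (b + 2 * ℓ + s) := by
    intro s hs
    simpa only [add_assoc] using eq_of_wordAt_eq hwin (t := 2 * ℓ + s) (by omega)
  have haL : a + 2 * ℓ + L ∈ Set.range fun k => cut σ ξ k + ℓ := by
    refine ⟨k, ?_⟩
    simp only [cut, ← hk]
    omega
  suffices hbL : b + 2 * ℓ + L ∈ Set.range fun k => cut σ ξ k + ℓ by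
    obtain ⟨k', hk'⟩ := hbL
    exact ⟨k', by simp only [cut] at hk'; omega⟩
  by_contra hbL
  have h0 : cut σ ξ 0 + ℓ = ℓ := by simp [cut, wordAt, subst]
  obtain ⟨p, hp1, hp2, hp⟩ := H.exists_period_of_disjoint hR (a := a + 2 * ℓ) (b := b + 2 * ℓ)
    (L := L) (by simp only [h0]; omega) (by simp only [h0]; omega) hab
    fun t ht hat hbt => hbL (H.mem_range_of_common_cut hab ht hat hbt haL)
  refine hW p hp1 hp2 (b + 2 * ℓ + 8 ^ R) fun n hn => ?_
  have := hp (8 ^ R + n) (by omega) (by omega)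
  simpa only [add_assoc] using this
end
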